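/- No line of divergence can end at an interior point of a boundary edge where the solutions blow up to +∞: Let (uₙ) be a sequence of solutions of the minimal surface equation on the open unit square (0,1)² such that for every n and every y₀ ∈ (0,1), uₙ(x,y) tends to +∞ as (x,y) ∈ (0,1)² tends to (1, y₀). Then no line of divergence of (uₙ) has (1, 1/2) as an end-point; that is, there do not exist a unit vector v ∈ ℝ², a length ℓ > 0 with L = {(1,1/2) + t·v : 0 < t < ℓ} ⊆ (0,1)², a unit vector N ∈ ℝ² orthogonal to v, and a strictly increasing sequence (n_k) of indices, such that for every point A ∈ L one has W_{n_k}(A) → +∞ and ∇u_{n_k}(A)/W_{n_k}(A) → N as k → ∞. -/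

import Mathlib

open Real Filter Set

/-- First partial derivative (in the `x` direction) of a function on `ℝ × ℝ`. -/
noncomputable def pd1 (u : ℝ × ℝ → ℝ) (z : ℝ × ℝ) : ℝ := fderiv ℝ u z (1, 0)

/-- Second partial derivative (in the `y` direction) of a function on `ℝ × ℝ`. -/
noncomputable def pd2 (u : ℝ × ℝ → ℝ) (z : ℝ × ℝ) : ℝ := fderiv ℝ u z (0, 1)

/-- `W = √(1 + p² + q²)` associated to a function `u` on `ℝ × ℝ`. -/
noncomputable def Wf (u : ℝ × ℝ → ℝ) (z : ℝ × ℝ) : ℝ :=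
  Real.sqrt (1 + pd1 u z ^ 2 + pd2 u z ^ 2)

/-- `u` is a solution of the minimal surface equation on the open set `U`. -/
def IsMSESolution (U : Set (ℝ × ℝ)) (u : ℝ × ℝ → ℝ) : Prop :=
  ContDiffOn ℝ 2 u U ∧ ∀ z ∈ U,
    (1 + pd2 u z ^ 2) * pd1 (pd1 u) z
      - 2 * pd1 u z * pd2 u z * pd2 (pd1 u) z
      + (1 + pd1 u z ^ 2) * pd2 (pd2 u) z = 0


open MeasureTheory

/-- The first component `p / W` of the unit-flux field `∇u / W`. -/
noncomputable def flux1 (u : ℝ × ℝ → ℝ) (z : ℝ × ℝ) : ℝ := pd1 u z / Wf u z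

/-- The second component `q / W` of the unit-flux field `∇u / W`. -/
noncomputable def flux2 (u : ℝ × ℝ → ℝ) (z : ℝ × ℝ) : ℝ := pd2 u z / Wf u z

lemma Wf_pos (u : ℝ × ℝ → ℝ) (z : ℝ × ℝ) : 0 < Wf u z :=
  Real.sqrt_pos.2 (by positivity)

lemma Wf_sq (u : ℝ × ℝ → ℝ) (z : ℝ × ℝ) : Wf u z ^ 2 = 1 + pd1 u z ^ 2 + pd2 u z ^ 2 :=
  Real.sq_sqrt (by positivity)

lemma flux_sq_add_sq_le (u : ℝ × ℝ → ℝ) (z : ℝ × ℝ) : flux1 u z ^ 2 + flux2 u z ^ 2 ≤ 1 := by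
  have h := Wf_sq u z
  have h0 := Wf_pos u z
  rw [flux1, flux2, div_pow, div_pow, ← add_div, div_le_one (by positivity)]
  linarith

lemma abs_flux1_le (u : ℝ × ℝ → ℝ) (z : ℝ × ℝ) : |flux1 u z| ≤ 1 :=
  abs_le_one_iff_mul_self_le_one.2 (by nlinarith [flux_sq_add_sq_le u z, sq_nonneg (flux2 u z)])

lemma abs_flux2_le (u : ℝ × ℝ → ℝ) (z : ℝ × ℝ) : |flux2 u z| ≤ 1 :=
  abs_le_one_iff_mul_self_le_one.2 (by nlinarith [flux_sq_add_sq_le u z, sq_nonneg (flux1 u z)])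

/-- The Dirichlet density `(p² + q²) / W` dominates `p - 1`. -/
lemma neg_one_le_flux_mul (u : ℝ × ℝ → ℝ) (z : ℝ × ℝ) :
    -1 ≤ (flux1 u z - 1) * pd1 u z + flux2 u z * pd2 u z := by
  have h := Wf_sq u z
  have h0 := Wf_pos u z
  have h1 : 1 ≤ Wf u z := by nlinarith [sq_nonneg (pd1 u z), sq_nonneg (pd2 u z)]
  have h2 : pd1 u z ≤ Wf u z := by
    apply le_of_sq_le_sq _ h0.le
    nlinarith [sq_nonneg (pd2 u z)]
  have h3 : (flux1 u z - 1) * pd1 u z + flux2 u z * pd2 u z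
      = Wf u z - 1 / Wf u z - pd1 u z := by
    rw [flux1, flux2]
    field_simp
    linarith
  have h4 : 1 / Wf u z ≤ 1 := by rw [div_le_one h0]; exact h1
  linarith

section Regularity

variable {U : Set (ℝ × ℝ)} {u : ℝ × ℝ → ℝ}

lemma contDiffOn_pd1 (hU : IsOpen U) (h : ContDiffOn ℝ 2 u U) : ContDiffOn ℝ 1 (pd1 u) U :=
  (h.fderiv_of_isOpen hU (m := 1) (by norm_num)).clm_apply contDiffOn_const

lemma contDiffOn_pd2 (hU : IsOpen U) (h : ContDiffOn ℝ 2 u U) : ContDiffOn ℝ 1 (pd2 u) U :=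
  (h.fderiv_of_isOpen hU (m := 1) (by norm_num)).clm_apply contDiffOn_const

lemma contDiffOn_Wf (hU : IsOpen U) (h : ContDiffOn ℝ 2 u U) : ContDiffOn ℝ 1 (Wf u) U :=
  ((contDiffOn_const.add ((contDiffOn_pd1 hU h).pow 2)).add
    ((contDiffOn_pd2 hU h).pow 2)).sqrt fun _ _ ↦ by positivity

lemma contDiffOn_flux1 (hU : IsOpen U) (h : ContDiffOn ℝ 2 u U) : ContDiffOn ℝ 1 (flux1 u) U :=
  (contDiffOn_pd1 hU h).div (contDiffOn_Wf hU h) fun z _ ↦ (Wf_pos u z).ne'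

lemma contDiffOn_flux2 (hU : IsOpen U) (h : ContDiffOn ℝ 2 u U) : ContDiffOn ℝ 1 (flux2 u) U :=
  (contDiffOn_pd2 hU h).div (contDiffOn_Wf hU h) fun z _ ↦ (Wf_pos u z).ne'

lemma differentiableAt_of_contDiffOn_one {f : ℝ × ℝ → ℝ} {z : ℝ × ℝ} (hU : IsOpen U)
    (hf : ContDiffOn ℝ 1 f U) (hz : z ∈ U) : DifferentiableAt ℝ f z :=
  (hf.contDiffAt (hU.mem_nhds hz)).differentiableAt one_ne_zero

lemma pd1_pd2_eq_pd2_pd1 {z : ℝ × ℝ} (hU : IsOpen U) (h : ContDiffOn ℝ 2 u U) (hz : z ∈ U) :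
    pd1 (pd2 u) z = pd2 (pd1 u) z := by
  have hc : ContDiffAt ℝ 2 u z := h.contDiffAt (hU.mem_nhds hz)
  have hd : DifferentiableAt ℝ (fderiv ℝ u) z :=
    (hc.fderiv_right (m := 1) (by norm_num)).differentiableAt one_ne_zero
  have key (v w : ℝ × ℝ) : fderiv ℝ (fun z ↦ fderiv ℝ u z v) z w
      = fderiv ℝ (fderiv ℝ u) z w v := by
    rw [fderiv_clm_apply hd (differentiableAt_const v)]
    simp
  have hs : IsSymmSndFDerivAt ℝ u z := hc.isSymmSndFDerivAt (by simp)
  change fderiv ℝ (fun z ↦ fderiv ℝ u z (0, 1)) z (1, 0)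
    = fderiv ℝ (fun z ↦ fderiv ℝ u z (1, 0)) z (0, 1)
  rw [key, key]
  exact hs.eq _ _

/-- The divergence form of the minimal surface equation. -/
lemma IsMSESolution.div_flux_eq_zero {z : ℝ × ℝ} (hU : IsOpen U) (h : IsMSESolution U u)
    (hz : z ∈ U) : fderiv ℝ (flux1 u) z (1, 0) + fderiv ℝ (flux2 u) z (0, 1) = 0 := by
  have hp := (differentiableAt_of_contDiffOn_one hU (contDiffOn_pd1 hU h.1) hz).hasFDerivAt
  have hq := (differentiableAt_of_contDiffOn_one hU (contDiffOn_pd2 hU h.1) hz).hasFDerivAt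
  have hW0 := Wf_pos u z
  have hW2 := Wf_sq u z
  have hW := (differentiableAt_of_contDiffOn_one hU (contDiffOn_Wf hU h.1) hz).hasFDerivAt
  have hWd : ∀ v, Wf u z * fderiv ℝ (Wf u) z v
      = pd1 u z * fderiv ℝ (pd1 u) z v + pd2 u z * fderiv ℝ (pd2 u) z v := by
    intro v
    have e := (hW.pow 2).unique ((((hp.pow 2).const_add 1).add (hq.pow 2)).congr_of_eventuallyEq
      (.of_forall fun y ↦ Wf_sq u y))
    have e := congrArg (fun f ↦ f v) e
    simp at e
    linarith
  have hquot : ∀ f : ℝ × ℝ → ℝ, DifferentiableAt ℝ f z →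
      DifferentiableAt ℝ (fun y ↦ f y / Wf u y) z → ∀ v,
      fderiv ℝ (fun y ↦ f y / Wf u y) z v
        = (fderiv ℝ f z v - f z / Wf u z * fderiv ℝ (Wf u) z v) / Wf u z := by
    intro f hf hfW v
    have e := (hfW.hasFDerivAt.mul hW).unique (hf.hasFDerivAt.congr_of_eventuallyEq
      (.of_forall fun y ↦ div_mul_cancel₀ _ (Wf_pos u y).ne'))
    have e := congrArg (fun f ↦ f v) e
    simp at e
    rw [eq_div_iff hW0.ne']
    linarith
  have h1 := hquot _ hp.differentiableAt
    (differentiableAt_of_contDiffOn_one hU (contDiffOn_flux1 hU h.1) hz) (1, 0)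
  have h2 := hquot _ hq.differentiableAt
    (differentiableAt_of_contDiffOn_one hU (contDiffOn_flux2 hU h.1) hz) (0, 1)
  have hsymm := pd1_pd2_eq_pd2_pd1 hU h.1 hz
  have heq := h.2 z hz
  have e1 : fderiv ℝ (Wf u) z (1, 0)
      = (pd1 u z * pd1 (pd1 u) z + pd2 u z * pd1 (pd2 u) z) / Wf u z := by
    rw [eq_div_iff hW0.ne', mul_comm]; exact hWd _
  have e2 : fderiv ℝ (Wf u) z (0, 1)
      = (pd1 u z * pd2 (pd1 u) z + pd2 u z * pd2 (pd2 u) z) / Wf u z := by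
    rw [eq_div_iff hW0.ne', mul_comm]; exact hWd _
  rw [e1, hsymm] at h1
  rw [e2] at h2
  change fderiv ℝ (fun y ↦ pd1 u y / Wf u y) z (1, 0)
    + fderiv ℝ (fun y ↦ pd2 u y / Wf u y) z (0, 1) = 0
  change _ = (pd1 (pd1 u) z - _) / _ at h1
  change _ = (pd2 (pd2 u) z - _) / _ at h2
  rw [h1, h2]
  field_simp
  rw [hW2]
  linarith

end Regularity

lemma abs_arctan_le_abs (x : ℝ) : |arctan x| ≤ |x| := by
  have key : ∀ y : ℝ, 0 ≤ y → arctan y ≤ y := fun y hy ↦ by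
    simpa using le_tan (arctan_nonneg.2 hy) (arctan_lt_pi_div_two y)
  rcases le_total 0 x with hx | hx
  · rw [abs_of_nonneg hx, abs_of_nonneg (arctan_nonneg.2 hx)]
    exact key x hx
  · rw [abs_of_nonpos hx, abs_of_nonpos (arctan_le_zero.2 hx), ← arctan_neg]
    exact key _ (neg_nonneg.2 hx)

lemma neg_mul_le_intervalIntegral {f : ℝ → ℝ} {a b c : ℝ} (hab : a ≤ b) (hc : 0 ≤ c)
    (hf : ∀ x ∈ Ioo a b, -c ≤ f x) : -(c * (b - a)) ≤ ∫ x in a..b, f x := by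
  by_cases hi : IntervalIntegrable f volume a b
  · have h := intervalIntegral.integral_mono_on_of_le_Ioo hab
      (intervalIntegrable_const (c := -c)) hi hf
    rw [intervalIntegral.integral_const, smul_eq_mul] at h
    linarith
  · rw [intervalIntegral.integral_undef hi]
    nlinarith

/-- The integral of the truncated flux defect over the right side of a rectangle is controlled by
the area, the lengths of the horizontal sides and the values on the left side. -/
lemma IsMSESolution.integral_arctan_mul_flux_defect_le {U : Set (ℝ × ℝ)} {u : ℝ × ℝ → ℝ}
    (hU : IsOpen U) (h : IsMSESolution U u) {κ x₀ x₁ a b : ℝ} (hκ : 0 ≤ κ)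
    (hx : x₀ ≤ x₁) (hab : a ≤ b) (hR : Icc x₀ x₁ ×ˢ Icc a b ⊆ U) :
    ∫ y in a..b, arctan (κ * u (x₁, y)) * (1 - flux1 u (x₁, y))
      ≤ κ * (b - a) * (x₁ - x₀) + π * (x₁ - x₀) + ∫ y in a..b, 2 * (κ * |u (x₀, y)|) := by
  have hu1 : ContDiffOn ℝ 1 u U := h.1.of_le (by norm_num)
  set H : ℝ × ℝ → ℝ := fun z ↦ arctan (κ * u z) with hH
  have hHc : ContDiffOn ℝ 1 H U := (contDiffOn_const.mul hu1).arctan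
  have hHabs : ∀ z, |H z| ≤ π / 2 := fun z ↦
    abs_le.2 ⟨(neg_pi_div_two_lt_arctan _).le, (arctan_lt_pi_div_two _).le⟩
  set f : ℝ × ℝ → ℝ := fun z ↦ H z * (flux1 u z - 1) with hf
  set g : ℝ × ℝ → ℝ := fun z ↦ H z * flux2 u z with hg
  have hfc : ContDiffOn ℝ 1 f U := hHc.mul ((contDiffOn_flux1 hU h.1).sub contDiffOn_const)
  have hgc : ContDiffOn ℝ 1 g U := hHc.mul (contDiffOn_flux2 hU h.1)
  have hsub : uIcc x₀ x₁ ×ˢ uIcc a b ⊆ U := by rwa [uIcc_of_le hx, uIcc_of_le hab]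
  have hsubo : Ioo (min x₀ x₁) (max x₀ x₁) ×ˢ Ioo (min a b) (max a b) ⊆ U := by
    rw [min_eq_left hx, max_eq_right hx, min_eq_left hab, max_eq_right hab]
    exact (Set.prod_mono Ioo_subset_Icc_self Ioo_subset_Icc_self).trans hR
  have hdiv := integral2_divergence_prod_of_hasFDerivAt f g (fderiv ℝ f) (fderiv ℝ g) x₀ a x₁ b
    (hfc.continuousOn.mono hsub) (hgc.continuousOn.mono hsub)
    (fun z hz ↦ (differentiableAt_of_contDiffOn_one hU hfc (hsubo hz)).hasFDerivAt)
    (fun z hz ↦ (differentiableAt_of_contDiffOn_one hU hgc (hsubo hz)).hasFDerivAt)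
    (ContinuousOn.integrableOn_compact (isCompact_uIcc.prod isCompact_uIcc)
      ((((hfc.continuousOn_fderiv_of_isOpen hU le_rfl).clm_apply continuousOn_const).add
      ((hgc.continuousOn_fderiv_of_isOpen hU le_rfl).clm_apply continuousOn_const)).mono hsub))
  have hpt : ∀ z ∈ U, -κ ≤ fderiv ℝ f z (1, 0) + fderiv ℝ g z (0, 1) := by
    intro z hz
    have hP := (differentiableAt_of_contDiffOn_one hU (contDiffOn_flux1 hU h.1) hz).hasFDerivAt
    have hQ := (differentiableAt_of_contDiffOn_one hU (contDiffOn_flux2 hU h.1) hz).hasFDerivAt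
    have hHd := ((differentiableAt_of_contDiffOn_one hU hu1 hz).hasFDerivAt.const_mul κ).arctan
    have e1 : HasFDerivAt f _ z := hHd.mul (hP.sub_const 1)
    have e2 : HasFDerivAt g _ z := hHd.mul hQ
    have e0 := h.div_flux_eq_zero hU hz
    have e3 := neg_one_le_flux_mul u z
    have hk : 1 / (1 + (κ * u z) ^ 2) ≤ 1 := by
      rw [div_le_one (by positivity)]; nlinarith [sq_nonneg (κ * u z)]
    have hk0 : 0 ≤ 1 / (1 + (κ * u z) ^ 2) := by positivity
    have e4 : fderiv ℝ f z (1, 0) + fderiv ℝ g z (0, 1)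
        = H z * (fderiv ℝ (flux1 u) z (1, 0) + fderiv ℝ (flux2 u) z (0, 1))
          + (1 / (1 + (κ * u z) ^ 2)) * κ
            * ((flux1 u z - 1) * pd1 u z + flux2 u z * pd2 u z) := by
      rw [e1.fderiv, e2.fderiv]
      simp [pd1, pd2, hH]
      ring
    rw [e4, e0]
    have : 1 / (1 + (κ * u z) ^ 2) * κ ≤ κ := mul_le_of_le_one_left hκ hk
    nlinarith [mul_nonneg hk0 hκ]
  have hlow : -(κ * (b - a) * (x₁ - x₀))
      ≤ ∫ x in x₀..x₁, ∫ y in a..b, fderiv ℝ f (x, y) (1, 0) + fderiv ℝ g (x, y) (0, 1) :=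
    neg_mul_le_intervalIntegral hx (mul_nonneg hκ (sub_nonneg.2 hab)) fun x hx' ↦
      neg_mul_le_intervalIntegral hab hκ fun y hy ↦
        hpt _ (hR ⟨Ioo_subset_Icc_self hx', Ioo_subset_Icc_self hy⟩)
  have hgabs : ∀ z, |g z| ≤ π / 2 := fun z ↦ by
    rw [hg, abs_mul]
    nlinarith [abs_flux2_le u z, hHabs z, abs_nonneg (H z), abs_nonneg (flux2 u z)]
  have hhor (y : ℝ) : |∫ x in x₀..x₁, g (x, y)| ≤ π / 2 * (x₁ - x₀) := by
    have := intervalIntegral.norm_integral_le_of_norm_le_const (a := x₀) (b := x₁)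
      (f := fun x ↦ g (x, y)) (C := π / 2) fun x _ ↦ hgabs (x, y)
    rwa [Real.norm_eq_abs, abs_of_nonneg (sub_nonneg.2 hx)] at this
  have hvert : ∀ x ∈ Icc x₀ x₁, ∀ F : ℝ × ℝ → ℝ, ContinuousOn F U →
      IntervalIntegrable (fun y ↦ F (x, y)) volume a b := by
    intro x hx' F hF
    refine ContinuousOn.intervalIntegrable_of_Icc hab ?_
    exact hF.comp (by fun_prop) fun y hy ↦ hR ⟨hx', hy⟩
  have hleft : -∫ y in a..b, f (x₀, y) ≤ ∫ y in a..b, 2 * (κ * |u (x₀, y)|) := by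
    rw [← intervalIntegral.integral_neg]
    refine intervalIntegral.integral_mono_on hab
      (hvert x₀ (left_mem_Icc.2 hx) f hfc.continuousOn).neg
      (hvert x₀ (left_mem_Icc.2 hx) (fun z ↦ 2 * (κ * |u z|))
        (continuousOn_const.mul (continuousOn_const.mul hu1.continuousOn.abs))) fun y _ ↦ ?_
    have h1 : |H (x₀, y)| ≤ κ * |u (x₀, y)| := by
      rw [show κ * |u (x₀, y)| = |κ * u (x₀, y)| by rw [abs_mul, abs_of_nonneg hκ]]
      exact abs_arctan_le_abs _
    have h2 : |flux1 u (x₀, y) - 1| ≤ 2 := by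
      have := abs_le.1 (abs_flux1_le u (x₀, y))
      exact abs_le.2 ⟨by linarith, by linarith⟩
    calc -f (x₀, y) ≤ |f (x₀, y)| := neg_le_abs _
      _ = |H (x₀, y)| * |flux1 u (x₀, y) - 1| := abs_mul _ _
      _ ≤ κ * |u (x₀, y)| * 2 := by gcongr
      _ = _ := by ring
  have hright : ∫ y in a..b, arctan (κ * u (x₁, y)) * (1 - flux1 u (x₁, y))
      = -∫ y in a..b, f (x₁, y) := by
    rw [← intervalIntegral.integral_neg]
    congr 1 with y
    simp only [hf, hH]
    ring
  rw [hright]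
  have := abs_le.1 (hhor a)
  have := abs_le.1 (hhor b)
  linarith

/-- Along an edge where `u` blows up to `+∞`, the flux of `∇u / W` is maximal. -/
lemma IsMSESolution.eventually_integral_flux_defect_lt {u : ℝ × ℝ → ℝ}
    (h : IsMSESolution (Ioo (0 : ℝ) 1 ×ˢ Ioo (0 : ℝ) 1) u)
    (hblow : ∀ y₀ ∈ Ioo (0 : ℝ) 1,
      Tendsto u (nhdsWithin ((1 : ℝ), y₀) (Ioo (0 : ℝ) 1 ×ˢ Ioo (0 : ℝ) 1)) atTop)
    {a b η : ℝ} (ha : 0 < a) (hab : a ≤ b) (hb : b < 1) (hη : 0 < η) :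
    ∀ᶠ x in nhdsWithin (1 : ℝ) (Iio 1), ∫ y in a..b, (1 - flux1 u (x, y)) < η := by
  set Q := Ioo (0 : ℝ) 1 ×ˢ Ioo (0 : ℝ) 1 with hQ
  have hU : IsOpen Q := isOpen_Ioo.prod isOpen_Ioo
  have hIcc : Icc a b ⊆ Ioo 0 1 := fun y hy ↦ ⟨ha.trans_le hy.1, hy.2.trans_lt hb⟩
  have hvert : ∀ x ∈ Ioo (0 : ℝ) 1, ∀ F : ℝ × ℝ → ℝ, ContinuousOn F Q →
      IntervalIntegrable (fun y ↦ F (x, y)) volume a b := fun x hx F hF ↦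
    ContinuousOn.intervalIntegrable_of_Icc hab <|
      hF.comp (by fun_prop) fun y hy ↦ ⟨hx, hIcc hy⟩
  obtain ⟨x₀, hx₀, hx₀'⟩ : ∃ x₀ ∈ Ioo (0 : ℝ) 1, 1 - x₀ < η / 10 :=
    ⟨max (1 / 2) (1 - η / 20), ⟨by positivity, by simp [hη]; norm_num⟩, by
      linarith [le_max_right (1 / 2) (1 - η / 20)]⟩
  set C := ∫ y in a..b, 2 * |u (x₀, y)| with hC
  have hC0 : 0 ≤ C := intervalIntegral.integral_nonneg hab fun _ _ ↦ by positivity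
  set κ := η / (10 * (1 + C)) with hκ
  have hκ0 : 0 < κ := by positivity
  have hκC : κ * (1 + C) = η / 10 := by rw [hκ]; field_simp
  have hflux : ContinuousOn (flux1 u) Q := (contDiffOn_flux1 hU h.1).continuousOn
  have huc : ContinuousOn u Q := h.1.continuousOn
  have hdefect (z : ℝ × ℝ) : |1 - flux1 u z| ≤ 2 := by
    have := abs_le.1 (abs_flux1_le u z)
    exact abs_le.2 ⟨by linarith, by linarith⟩
  have hev : ∀ᶠ x in nhdsWithin (1 : ℝ) (Iio 1), x ∈ Ioo x₀ 1 := Ioo_mem_nhdsLT hx₀.2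
  have hlim : Tendsto (fun x ↦ ∫ y in a..b,
      (π / 2 - arctan (κ * u (x, y))) * (1 - flux1 u (x, y)))
      (nhdsWithin (1 : ℝ) (Iio 1)) (nhds 0) := by
    have h0 : (0 : ℝ) = ∫ y in a..b, (0 : ℝ) := by simp
    rw [h0]
    refine intervalIntegral.tendsto_integral_filter_of_dominated_convergence (fun _ ↦ π * 2)
      ?_ ?_ intervalIntegrable_const ?_
    · filter_upwards [hev] with x hx
      exact (hvert x ⟨hx₀.1.trans hx.1, hx.2⟩
        (fun z ↦ (π / 2 - arctan (κ * u z)) * (1 - flux1 u z))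
        ((continuousOn_const.sub (continuous_arctan.comp_continuousOn
          (continuousOn_const.mul huc))).mul (continuousOn_const.sub hflux))).def'.aestronglyMeasurable
    · refine .of_forall fun x ↦ .of_forall fun y _ ↦ ?_
      rw [norm_mul]
      have h1 := neg_pi_div_two_lt_arctan (κ * u (x, y))
      have h2 := arctan_lt_pi_div_two (κ * u (x, y))
      refine mul_le_mul ?_ (hdefect _) (norm_nonneg _) pi_pos.le
      exact abs_le.2 ⟨by linarith [pi_pos], by linarith⟩
    · refine .of_forall fun y hy ↦ ?_
      rw [uIoc_of_le hab] at hy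
      have hy' : y ∈ Ioo (0 : ℝ) 1 := hIcc (Ioc_subset_Icc_self hy)
      have ht : Tendsto (fun x : ℝ ↦ (x, y)) (nhdsWithin 1 (Iio 1))
          (nhdsWithin ((1 : ℝ), y) Q) := by
        refine tendsto_nhdsWithin_iff.2 ⟨?_, ?_⟩
        · exact ((by fun_prop : Continuous fun x : ℝ ↦ (x, y)).tendsto 1).mono_left
            nhdsWithin_le_nhds
        · filter_upwards [hev] with x hx
          exact ⟨⟨hx₀.1.trans hx.1, hx.2⟩, hy'⟩
      have hu := ((hblow y hy').comp ht).const_mul_atTop hκ0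
      have hat := (tendsto_arctan_atTop.mono_right nhdsWithin_le_nhds).comp hu
      have hz := (hat.const_sub (π / 2))
      rw [sub_self] at hz
      exact hz.zero_mul_isBoundedUnder_le
        (isBoundedUnder_of ⟨2, fun x ↦ hdefect _⟩)
  filter_upwards [hev, hlim.eventually_lt_const (show (0 : ℝ) < η / 10 by positivity)]
    with x hx hsmall
  have hxQ : x ∈ Ioo (0 : ℝ) 1 := ⟨hx₀.1.trans hx.1, hx.2⟩
  have hkey := h.integral_arctan_mul_flux_defect_le hU (κ := κ) (x₀ := x₀) (x₁ := x) (a := a)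
    (b := b) hκ0.le hx.1.le hab
    (Set.prod_mono (fun t ht ↦ ⟨hx₀.1.trans_le ht.1, ht.2.trans_lt hx.2⟩) hIcc)
  have hCκ : ∫ y in a..b, 2 * (κ * |u (x₀, y)|) = κ * C := by
    rw [hC, ← intervalIntegral.integral_const_mul]
    congr 1 with y
    ring
  have hsum : π / 2 * ∫ y in a..b, (1 - flux1 u (x, y))
      = (∫ y in a..b, (π / 2 - arctan (κ * u (x, y))) * (1 - flux1 u (x, y)))
        + ∫ y in a..b, arctan (κ * u (x, y)) * (1 - flux1 u (x, y)) := by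
    have hA : ContinuousOn (fun z ↦ arctan (κ * u z)) Q :=
      continuous_arctan.comp_continuousOn (continuousOn_const.mul huc)
    rw [← intervalIntegral.integral_add
      (hvert x hxQ (fun z ↦ (π / 2 - arctan (κ * u z)) * (1 - flux1 u z))
        ((continuousOn_const.sub hA).mul (continuousOn_const.sub hflux)))
      (hvert x hxQ (fun z ↦ arctan (κ * u z) * (1 - flux1 u z))
        (hA.mul (continuousOn_const.sub hflux))),
      ← intervalIntegral.integral_const_mul]
    congr 1 with y
    ring
  rw [hCκ] at hkey
  have h1 : κ * (b - a) * (x - x₀) ≤ κ := by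
    have : (b - a) * (x - x₀) ≤ 1 := by nlinarith [hx.1, hx.2, hx₀.1]
    rw [mul_assoc]
    exact mul_le_of_le_one_right hκ0.le this
  have h2 : π * (x - x₀) ≤ 3.2 * (η / 10) := by
    have : π < 3.2 := by linarith [pi_lt_d2]
    have := hx.1
    have := hx.2
    gcongr
    linarith
  have h3 := pi_gt_three
  by_contra! hcon
  nlinarith

/-- The conjugate function of a solution of the minimal surface equation. -/
lemma IsMSESolution.exists_conjugate {U : Set (ℝ × ℝ)} {u : ℝ × ℝ → ℝ} (hU : IsOpen U)
    (hconv : Convex ℝ U) (h : IsMSESolution U u) :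
    ∃ Ψ : ℝ × ℝ → ℝ, ∀ z ∈ U, HasFDerivAt Ψ
      (flux1 u z • ContinuousLinearMap.snd ℝ ℝ ℝ - flux2 u z • ContinuousLinearMap.fst ℝ ℝ ℝ) z := by
  have hd : ∀ z ∈ U, HasFDerivAt (fun z ↦ flux1 u z • ContinuousLinearMap.snd ℝ ℝ ℝ
      - flux2 u z • ContinuousLinearMap.fst ℝ ℝ ℝ) _ z := fun z hz ↦
    ((differentiableAt_of_contDiffOn_one hU (contDiffOn_flux1 hU h.1) hz).hasFDerivAt.smul_const
      (ContinuousLinearMap.snd ℝ ℝ ℝ)).sub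
    ((differentiableAt_of_contDiffOn_one hU (contDiffOn_flux2 hU h.1) hz).hasFDerivAt.smul_const
      (ContinuousLinearMap.fst ℝ ℝ ℝ))
  refine hconv.exists_forall_hasFDerivAt_of_fderiv_symmetric hU
    (fun z hz ↦ (hd z hz).differentiableAt.differentiableWithinAt) fun z hz x y ↦ ?_
  have hsplit (L : ℝ × ℝ →L[ℝ] ℝ) (w : ℝ × ℝ) : L w = w.1 * L (1, 0) + w.2 * L (0, 1) := by
    have : w = w.1 • ((1 : ℝ), (0 : ℝ)) + w.2 • ((0 : ℝ), (1 : ℝ)) := by ext <;> simp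
    conv_lhs => rw [this, map_add, map_smul, map_smul]
    simp
  have h0 := h.div_flux_eq_zero hU hz
  rw [(hd z hz).fderiv]
  simp only [sub_apply, ContinuousLinearMap.smulRight_apply,
    smul_apply, ContinuousLinearMap.coe_snd', ContinuousLinearMap.coe_fst',
    smul_eq_mul]
  rw [hsplit (fderiv ℝ (flux1 u) z) x, hsplit (fderiv ℝ (flux1 u) z) y,
    hsplit (fderiv ℝ (flux2 u) z) x, hsplit (fderiv ℝ (flux2 u) z) y]
  linear_combination (x.1 * y.2 - y.1 * x.2) * h0

section Conjugate

variable {U : Set (ℝ × ℝ)} {u Ψ : ℝ × ℝ → ℝ}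

/-- A conjugate function is `1`-Lipschitz for the Euclidean distance. -/
lemma abs_conjugate_sub_le (hconv : Convex ℝ U)
    (hΨ : ∀ z ∈ U, HasFDerivAt Ψ
      (flux1 u z • ContinuousLinearMap.snd ℝ ℝ ℝ - flux2 u z • ContinuousLinearMap.fst ℝ ℝ ℝ) z)
    {z w : ℝ × ℝ} (hz : z ∈ U) (hw : w ∈ U) {D : ℝ} (hD : 0 ≤ D)
    (hzw : (w.1 - z.1) ^ 2 + (w.2 - z.2) ^ 2 ≤ D ^ 2) : |Ψ w - Ψ z| ≤ D := by
  obtain ⟨c, -, hc⟩ := domain_mvt (fun x hx ↦ (hΨ x hx).hasFDerivWithinAt) hconv hz hw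
  have hflux := flux_sq_add_sq_le u c
  refine abs_le_of_sq_le_sq ?_ hD
  rw [hc]
  simp only [sub_apply, smul_apply, ContinuousLinearMap.coe_snd', ContinuousLinearMap.coe_fst',
    smul_eq_mul, Prod.snd_sub, Prod.fst_sub]
  set p := flux1 u c
  set q := flux2 u c
  set x := w.1 - z.1
  set y := w.2 - z.2
  calc (p * y - q * x) ^ 2 ≤ (p ^ 2 + q ^ 2) * (x ^ 2 + y ^ 2) := by
        nlinarith [sq_nonneg (p * x + q * y)]
    _ ≤ 1 * (x ^ 2 + y ^ 2) := by gcongr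
    _ ≤ D ^ 2 := by linarith

/-- The increment of a conjugate function along a segment is the flux through it. -/
lemma conjugate_sub_eq_integral (hU : IsOpen U) (h : ContDiffOn ℝ 2 u U)
    (hΨ : ∀ z ∈ U, HasFDerivAt Ψ
      (flux1 u z • ContinuousLinearMap.snd ℝ ℝ ℝ - flux2 u z • ContinuousLinearMap.fst ℝ ℝ ℝ) z)
    {A v : ℝ × ℝ} {s t : ℝ} (hst : s ≤ t) (hL : ∀ r ∈ Icc s t, A + r • v ∈ U) :
    Ψ (A + t • v) - Ψ (A + s • v)
      = ∫ r in s..t, (flux1 u (A + r • v) * v.2 - flux2 u (A + r • v) * v.1) := by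
  symm
  have hcont (F : ℝ × ℝ → ℝ) (hF : ContinuousOn F U) :
      ContinuousOn (fun r : ℝ ↦ F (A + r • v)) (Icc s t) :=
    hF.comp (by fun_prop) hL
  refine intervalIntegral.integral_eq_sub_of_hasDerivAt (f := fun r ↦ Ψ (A + r • v)) ?_ ?_
  · intro r hr
    rw [uIcc_of_le hst] at hr
    have hline : HasDerivAt (fun r : ℝ ↦ A + r • v) v r := by
      simpa using ((hasDerivAt_id r).smul_const v).const_add A
    have := (hΨ _ (hL r hr)).comp_hasDerivAt r hline
    simpa [Function.comp_def] using this
  · exact ContinuousOn.intervalIntegrable_of_Icc hst <|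
      ((hcont _ (contDiffOn_flux1 hU h).continuousOn).mul continuousOn_const).sub
        ((hcont _ (contDiffOn_flux2 hU h).continuousOn).mul continuousOn_const)

end Conjugate

/-- If `∇uₖ / Wₖ` converges to `N` along a segment, then the increments of the conjugate functions
converge to the flux of `N` through it. -/
lemma tendsto_conjugate_sub {U : Set (ℝ × ℝ)} {u Ψ : ℕ → ℝ × ℝ → ℝ} (hU : IsOpen U)
    (hu : ∀ k, ContDiffOn ℝ 2 (u k) U)
    (hΨ : ∀ k, ∀ z ∈ U, HasFDerivAt (Ψ k) (flux1 (u k) z • ContinuousLinearMap.snd ℝ ℝ ℝ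
      - flux2 (u k) z • ContinuousLinearMap.fst ℝ ℝ ℝ) z)
    {A v N : ℝ × ℝ} {s t : ℝ} (hst : s ≤ t) (hL : ∀ r ∈ Icc s t, A + r • v ∈ U)
    (hlim : ∀ r ∈ Icc s t, Tendsto (fun k ↦ (flux1 (u k) (A + r • v), flux2 (u k) (A + r • v)))
      atTop (nhds N)) :
    Tendsto (fun k ↦ Ψ k (A + t • v) - Ψ k (A + s • v)) atTop
      (nhds ((N.1 * v.2 - N.2 * v.1) * (t - s))) := by
  have hconst : (N.1 * v.2 - N.2 * v.1) * (t - s) = ∫ _ in s..t, (N.1 * v.2 - N.2 * v.1) := by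
    simp; ring
  have hcont (k : ℕ) (F : ℝ × ℝ → ℝ) (hF : ContinuousOn F U) :
      ContinuousOn (fun r : ℝ ↦ F (A + r • v)) (Icc s t) :=
    hF.comp (by fun_prop) fun r hr ↦ hL r hr
  simp_rw [fun k ↦ conjugate_sub_eq_integral hU (hu k) (hΨ k) hst
    fun r hr ↦ hL r hr]
  rw [hconst]
  refine intervalIntegral.tendsto_integral_filter_of_dominated_convergence
    (fun _ ↦ |v.2| + |v.1|) (.of_forall fun k ↦ ?_) (.of_forall fun k ↦ .of_forall fun r _ ↦ ?_)
    intervalIntegrable_const (.of_forall fun r hr ↦ ?_)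
  · exact (ContinuousOn.intervalIntegrable_of_Icc (μ := volume) hst <|
      ((hcont k _ (contDiffOn_flux1 hU (hu k)).continuousOn).mul continuousOn_const).sub
        ((hcont k _ (contDiffOn_flux2 hU (hu k)).continuousOn).mul
          continuousOn_const)).def'.aestronglyMeasurable
  · refine (abs_sub _ _).trans ?_
    rw [abs_mul, abs_mul]
    exact add_le_add (mul_le_of_le_one_left (abs_nonneg _) (abs_flux1_le _ _))
      (mul_le_of_le_one_left (abs_nonneg _) (abs_flux2_le _ _))
  · rw [uIoc_of_le hst] at hr
    have hN := hlim r (Ioc_subset_Icc_self hr)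
    have hN1 := (continuous_fst.tendsto N).comp hN
    have hN2 := (continuous_snd.tendsto N).comp hN
    exact (hN1.mul_const v.2).sub (hN2.mul_const v.1)

/-- Along an edge where `u` blows up to `+∞`, a conjugate function grows with slope `1`. -/
lemma IsMSESolution.eventually_lt_conjugate_sub {u Ψ : ℝ × ℝ → ℝ}
    (h : IsMSESolution (Ioo (0 : ℝ) 1 ×ˢ Ioo (0 : ℝ) 1) u)
    (hblow : ∀ y₀ ∈ Ioo (0 : ℝ) 1,
      Tendsto u (nhdsWithin ((1 : ℝ), y₀) (Ioo (0 : ℝ) 1 ×ˢ Ioo (0 : ℝ) 1)) atTop)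
    (hΨ : ∀ z ∈ Ioo (0 : ℝ) 1 ×ˢ Ioo (0 : ℝ) 1, HasFDerivAt Ψ
      (flux1 u z • ContinuousLinearMap.snd ℝ ℝ ℝ - flux2 u z • ContinuousLinearMap.fst ℝ ℝ ℝ) z)
    {a b η : ℝ} (ha : 0 < a) (hab : a ≤ b) (hb : b < 1) (hη : 0 < η) :
    ∀ᶠ x in nhdsWithin (1 : ℝ) (Iio 1), b - a - η < Ψ (x, b) - Ψ (x, a) := by
  have hU : IsOpen (Ioo (0 : ℝ) 1 ×ˢ Ioo (0 : ℝ) 1) := isOpen_Ioo.prod isOpen_Ioo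
  filter_upwards [h.eventually_integral_flux_defect_lt hblow ha hab hb
    hη, Ioo_mem_nhdsLT (zero_lt_one' ℝ)] with x hx hx01
  have hseg : ∀ r ∈ Icc a b, ((x, 0) : ℝ × ℝ) + r • ((0, 1) : ℝ × ℝ)
      ∈ Ioo (0 : ℝ) 1 ×ˢ Ioo (0 : ℝ) 1 := fun r hr ↦ by
    simpa using ⟨hx01, ha.trans_le hr.1, hr.2.trans_lt hb⟩
  have hinc := conjugate_sub_eq_integral hU h.1 hΨ hab hseg
  have hint : IntervalIntegrable (fun y ↦ flux1 u (x, y)) volume a b :=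
    ContinuousOn.intervalIntegrable_of_Icc hab <|
      (contDiffOn_flux1 hU h.1).continuousOn.comp (by fun_prop) fun r hr ↦
        ⟨hx01, ha.trans_le hr.1, hr.2.trans_lt hb⟩
  rw [intervalIntegral.integral_sub intervalIntegrable_const hint] at hx
  simp at hinc hx
  linarith

/-- **No line of divergence ends at an interior boundary point where the solutions
blow up to `+∞`** (Lemma `lemdiv1` of the paper): if `(uₙ)` are solutions of the MSE
on the open unit square blowing up to `+∞` at every point `(1,y₀)` of the right edge,
then there is no line of divergence of `(uₙ)` with end-point `(1,1/2)`. -/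
theorem stmt_4 (u : ℕ → ℝ × ℝ → ℝ)
    (Q : Set (ℝ × ℝ)) (hQ : Q = Set.Ioo (0 : ℝ) 1 ×ˢ Set.Ioo (0 : ℝ) 1)
    (hu : ∀ n, IsMSESolution Q (u n))
    (hblow : ∀ n, ∀ y₀ ∈ Set.Ioo (0 : ℝ) 1,
      Tendsto (u n) (nhdsWithin ((1 : ℝ), y₀) Q) atTop) :
    ¬ ∃ (v N : ℝ × ℝ) (ℓ : ℝ) (nk : ℕ → ℕ),
        v.1 ^ 2 + v.2 ^ 2 = 1 ∧ 0 < ℓ ∧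
        (∀ t ∈ Set.Ioo (0 : ℝ) ℓ, ((1 : ℝ), (1 / 2 : ℝ)) + t • v ∈ Q) ∧
        N.1 ^ 2 + N.2 ^ 2 = 1 ∧ v.1 * N.1 + v.2 * N.2 = 0 ∧
        StrictMono nk ∧
        ∀ t ∈ Set.Ioo (0 : ℝ) ℓ,
          Tendsto (fun k => Wf (u (nk k)) (((1 : ℝ), (1 / 2 : ℝ)) + t • v)) atTop atTop ∧
          Tendsto (fun k =>
              ((pd1 (u (nk k)) (((1 : ℝ), (1 / 2 : ℝ)) + t • v) /
                  Wf (u (nk k)) (((1 : ℝ), (1 / 2 : ℝ)) + t • v),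
                pd2 (u (nk k)) (((1 : ℝ), (1 / 2 : ℝ)) + t • v) /
                  Wf (u (nk k)) (((1 : ℝ), (1 / 2 : ℝ)) + t • v)) : ℝ × ℝ))
            atTop (nhds N) := by
  rintro ⟨v, N, ℓ, nk, hv, hℓ, hL, hN, hvN, -, hlim⟩
  subst hQ
  have hU : IsOpen (Ioo (0 : ℝ) 1 ×ˢ Ioo (0 : ℝ) 1) := isOpen_Ioo.prod isOpen_Ioo
  have hconv : Convex ℝ (Ioo (0 : ℝ) 1 ×ˢ Ioo (0 : ℝ) 1) := (convex_Ioo 0 1).prod (convex_Ioo 0 1)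
  choose Ψ hΨ using fun n ↦ (hu n).exists_conjugate hU hconv
  obtain ⟨t, ht⟩ : ∃ t, t = ℓ / 2 := ⟨_, rfl⟩
  have htℓ : t ∈ Ioo 0 ℓ := by constructor <;> linarith
  have hv1 : v.1 < 0 := by
    have h1 : 1 + t * v.1 < 1 := by simpa using (hL t htℓ).1.2
    nlinarith [htℓ.1]
  obtain ⟨σ, hσ⟩ : ∃ σ, σ = N.1 * v.2 - N.2 * v.1 := ⟨_, rfl⟩
  have hσ2 : σ ^ 2 = 1 := by
    have : σ ^ 2 = (v.1 ^ 2 + v.2 ^ 2) * (N.1 ^ 2 + N.2 ^ 2) - (v.1 * N.1 + v.2 * N.2) ^ 2 := by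
      rw [hσ]; ring
    rw [this, hv, hN, hvN]; norm_num
  have hσv : σ * v.2 < 1 := by
    by_contra! hcon
    have : (σ * v.2) ^ 2 = 1 - v.1 ^ 2 := by rw [mul_pow, hσ2]; linarith
    nlinarith [sq_pos_of_neg hv1]
  -- The third side of the triangle with sides `t` on `L` and `1 / 4` on the edge.
  obtain ⟨D, hD⟩ : ∃ D, D = √(t ^ 2 + (1 / 4) ^ 2 + 2 * (1 / 4) * t * (σ * v.2)) := ⟨_, rfl⟩
  have hσv' : -1 ≤ σ * v.2 := by
    have : (σ * v.2) ^ 2 = 1 - v.1 ^ 2 := by rw [mul_pow, hσ2]; linarith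
    nlinarith [sq_nonneg v.1]
  have ht0 := htℓ.1
  have hD2 : D ^ 2 = t ^ 2 + (1 / 4) ^ 2 + 2 * (1 / 4) * t * (σ * v.2) := by
    rw [hD]
    exact Real.sq_sqrt (by nlinarith [sq_nonneg (t - 1 / 4)])
  have hD0 : 0 ≤ D := hD ▸ Real.sqrt_nonneg _
  have hgap : D < t + 1 / 4 := by
    apply lt_of_pow_lt_pow_left₀ 2 (by positivity)
    nlinarith
  obtain ⟨g, hg⟩ : ∃ g, g = t + 1 / 4 - D := ⟨_, rfl⟩
  have hg0 : 0 < g := by linarith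
  obtain ⟨s, hs⟩ : ∃ s, s = min (g / 10) (t / 2) := ⟨_, rfl⟩
  have hs0 : 0 < s := by rw [hs]; positivity
  have hsg : s ≤ g / 10 := hs ▸ min_le_left _ _
  have hst : s ≤ t := by linarith [hs ▸ min_le_right (g / 10) (t / 2)]
  have hsℓ : s ∈ Ioo 0 ℓ := ⟨hs0, hst.trans_lt htℓ.2⟩
  have hIcc : Icc s t ⊆ Ioo 0 ℓ := fun r hr ↦ ⟨hs0.trans_le hr.1, hr.2.trans_lt htℓ.2⟩
  obtain ⟨A, hA⟩ : ∃ A : ℝ × ℝ, A = (1, 1 / 2) := ⟨_, rfl⟩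
  rw [← hA] at hL hlim
  -- The flux through `L` tends to `σ` times the length.
  have hflux : Tendsto (fun k ↦ Ψ (nk k) (A + t • v) - Ψ (nk k) (A + s • v)) atTop
      (nhds (σ * (t - s))) := by
    rw [hσ]
    exact tendsto_conjugate_sub hU (fun k ↦ (hu (nk k)).1) (fun k ↦ hΨ (nk k)) hst
      (fun r hr ↦ hL r (hIcc hr)) fun r hr ↦ (hlim r (hIcc hr)).2
  obtain ⟨k, hk⟩ := (((hflux.const_mul σ).eventually_const_lt
    (show t - s - g / 10 < σ * (σ * (t - s)) by
      rw [← mul_assoc, ← sq, hσ2]; linarith))).exists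
  obtain ⟨n, hn⟩ : ∃ n, n = nk k := ⟨_, rfl⟩
  rw [← hn] at hk
  have hedge : ∀ a b : ℝ, 0 < a → a ≤ b → b < 1 → ∀ᶠ x in nhdsWithin (1 : ℝ) (Iio 1),
      b - a - g / 10 < Ψ n (x, b) - Ψ n (x, a) :=
    fun a b ha hab hb ↦ (hu n).eventually_lt_conjugate_sub (hblow n) (hΨ n) ha hab hb
      (by positivity)
  -- The point of the edge at distance `1 / 4` from `(1, 1 / 2)`, on the side selected by `σ`.
  obtain ⟨c, hc⟩ : ∃ c, c = 1 / 2 - σ / 4 := ⟨_, rfl⟩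
  have hcmem : c ∈ Ioo (0 : ℝ) 1 := by
    have := abs_le_one_iff_mul_self_le_one.2 (show σ * σ ≤ 1 by nlinarith)
    rw [abs_le] at this
    constructor <;> linarith
  have hedge' : ∀ᶠ x in nhdsWithin (1 : ℝ) (Iio 1),
      1 / 4 - g / 10 < -σ * (Ψ n (x, c) - Ψ n (x, 1 / 2)) := by
    rcases mul_self_eq_one_iff.1 (sq σ ▸ hσ2) with h1 | h1
    · filter_upwards [hedge c (1 / 2) hcmem.1 (by linarith) (by norm_num)] with x hx
      rw [h1]
      linarith
    · filter_upwards [hedge (1 / 2) c (by norm_num) (by linarith) hcmem.2] with x hx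
      rw [h1]
      linarith
  obtain ⟨x, hx, hxI⟩ := (hedge'.and (Ioo_mem_nhdsLT
    (show max 0 (1 - g / 10) < 1 by simp [hg0]))).exists
  have hx0 : 0 < x := (le_max_left _ _).trans_lt hxI.1
  have hxg : 1 - g / 10 < x := (le_max_right _ _).trans_lt hxI.1
  have hx1 : x < 1 := hxI.2
  have hcorner : |Ψ n (x, 1 / 2) - Ψ n (A + s • v)| ≤ s + (1 - x) := by
    refine abs_conjugate_sub_le hconv (hΨ n) (hL s hsℓ)
      ⟨⟨hx0, hx1⟩, by norm_num, by norm_num⟩ (by linarith) ?_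
    have e := mul_nonneg (mul_pos hs0 (sub_pos.2 hx1)).le (show 0 ≤ 1 - v.1 by linarith)
    simp only [hA, Prod.fst_add, Prod.snd_add, Prod.smul_fst, Prod.smul_snd, smul_eq_mul]
    linear_combination 2 * e + s ^ 2 * hv
  have hside : |Ψ n (x, c) - Ψ n (A + t • v)| ≤ D + (1 - x) := by
    refine abs_conjugate_sub_le hconv (hΨ n) (hL t htℓ) ⟨⟨hx0, hx1⟩, hcmem⟩ (by linarith) ?_
    have e1 := mul_nonneg hD0 (sub_pos.2 hx1).le
    have e2 := mul_nonneg (mul_pos ht0 (sub_pos.2 hx1)).le (neg_nonneg.2 hv1.le)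
    simp only [hA, hc, Prod.fst_add, Prod.snd_add, Prod.smul_fst, Prod.smul_snd, smul_eq_mul]
    linear_combination 2 * e1 + 2 * e2 + t ^ 2 * hv - hD2 + hσ2 / 16
  have hσabs : |σ| = 1 := by rw [← sq_eq_sq₀ (abs_nonneg _) zero_le_one, sq_abs, hσ2]; norm_num
  have hcorner' : |σ * (Ψ n (x, 1 / 2) - Ψ n (A + s • v))| ≤ s + (1 - x) := by
    rwa [abs_mul, hσabs, one_mul]
  have hside' : |σ * (Ψ n (x, c) - Ψ n (A + t • v))| ≤ D + (1 - x) := by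
    rwa [abs_mul, hσabs, one_mul]
  rw [abs_le] at hcorner' hside'
  linarith
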